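/- Let P = {x ∈ ℝⁿ | Lᵢ(x) > 0 for 1 ≤ i ≤ N} be a bounded convex polytope with non-empty interior defined by N affine maps L₁, …, L_N : ℝⁿ → ℝ, and let dLᵢ denote the linear part of Lᵢ. Then the map Φ_b : int P → (ℝⁿ)* defined by Φ_b(x) = Σ_{i=1}^{N} log(Lᵢ(x))·dLᵢ is a bijection onto the dual space (ℝⁿ)* and is bi-Lipschitz from (int P, d_P) to (ℝⁿ)* equipped with the dual Euclidean norm: there is a constant A ≥ 1 with (1/A)·‖Φ_b(x) − Φ_b(y)‖ ≤ d_P(x,y) ≤ A·‖Φ_b(x) − Φ_b(y)‖ for all x, y ∈ int P. -/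

import Mathlib

open Set Filter MeasureTheory

noncomputable section

abbrev Euc (n : ℕ) := EuclideanSpace ℝ (Fin n)

/-- `Ω` is a convex domain: a non-empty bounded open convex subset of `ℝⁿ`. -/
def IsConvexDomain {n : ℕ} (Ω : Set (Euc n)) : Prop :=
  Ω.Nonempty ∧ IsOpen Ω ∧ Bornology.IsBounded Ω ∧ Convex ℝ Ω

/-- `d` is the Hilbert distance of the convex domain `Ω` : for distinct `p q ∈ Ω`, if `a` and
`b` are the points where the line through `p` and `q` meets `∂Ω`, in the order `a, p, q, b`
(`a = p + s•(q-p)` with `s < 0`, `b = p + t•(q-p)` with `t > 1`), then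
`d p q = ½ log [a,p,q,b]`, and `d p p = 0`. -/
def IsHilbertDist {n : ℕ} (Ω : Set (Euc n)) (d : Euc n → Euc n → ℝ) : Prop :=
  (∀ p ∈ Ω, d p p = 0) ∧
  ∀ p ∈ Ω, ∀ q ∈ Ω, p ≠ q → ∀ a b : Euc n,
    a ∈ frontier Ω → b ∈ frontier Ω →
    (∃ s t : ℝ, s < 0 ∧ 1 < t ∧ a = p + s • (q - p) ∧ b = p + t • (q - p)) →
    d p q = (1/2) * Real.log ((‖q - a‖ / ‖p - a‖) * (‖p - b‖ / ‖q - b‖))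

section SignCone

variable {E : Type*} [NormedAddCommGroup E] [NormedSpace ℝ E] {ι : Type*}

/-- Coefficient vectors `u` whose signs are those of `i ↦ m i v` for some `v`, up to replacing
nonzero signs by zero. -/
def signCone (m : ι → E →L[ℝ] ℝ) : Set (ι → ℝ) :=
  {u | ∃ v, ∀ i, 0 ≤ m i v * u i ∧ (m i v = 0 → u i = 0)}

lemma smul_mem_signCone {m : ι → E →L[ℝ] ℝ} {u : ι → ℝ} (hu : u ∈ signCone m) {r : ℝ}
    (hr : 0 ≤ r) : r • u ∈ signCone m := by
  obtain ⟨v, hv⟩ := hu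
  refine ⟨v, fun i => ⟨?_, fun h => ?_⟩⟩
  · have := mul_nonneg hr (hv i).1
    simp only [Pi.smul_apply, smul_eq_mul]
    linarith
  · simp [(hv i).2 h]

variable [Fintype ι]

lemma eq_zero_of_mem_signCone {m : ι → E →L[ℝ] ℝ} {u : ι → ℝ} (hu : u ∈ signCone m)
    (h : ∑ i, u i • m i = 0) : u = 0 := by
  obtain ⟨v, hv⟩ := hu
  have h0 : ∑ i, m i v * u i = 0 := by
    have := DFunLike.congr_fun h v
    simpa [_root_.sum_apply, mul_comm] using this
  rw [Finset.sum_eq_zero_iff_of_nonneg fun i _ => (hv i).1] at h0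
  funext i
  rcases mul_eq_zero.1 (h0 i (Finset.mem_univ i)) with h1 | h1
  · exact (hv i).2 h1
  · exact h1

lemma isClosed_signCone (m : ι → E →L[ℝ] ℝ) : IsClosed (signCone m) := by
  have : signCone m = ⋃ σ ∈ {σ : ι → SignType | ∃ v, ∀ i, SignType.sign (m i v) = σ i},
      {u : ι → ℝ | ∀ i, 0 ≤ (σ i : ℝ) * u i ∧ (σ i = 0 → u i = 0)} := by
    have key (a b : ℝ) : 0 ≤ a * b ↔ 0 ≤ ((SignType.sign a : SignType) : ℝ) * b := by
      rcases lt_trichotomy a 0 with h | h | h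
      · rw [sign_neg h, SignType.coe_neg_one, neg_one_mul, neg_nonneg]
        exact ⟨fun hb => nonpos_of_mul_nonneg_right hb h,
          mul_nonneg_of_nonpos_of_nonpos h.le⟩
      · simp [h]
      · simp [sign_pos h, mul_nonneg_iff_of_pos_left h]
    ext u
    simp only [signCone, mem_ofPred_eq, mem_iUnion, exists_prop]
    constructor
    · rintro ⟨v, hv⟩
      refine ⟨fun i => SignType.sign (m i v), ⟨v, fun i => rfl⟩, fun i => ⟨(key _ _).1 (hv i).1, ?_⟩⟩
      simpa [sign_eq_zero_iff] using (hv i).2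
    · rintro ⟨σ, ⟨v, hσ⟩, hu⟩
      refine ⟨v, fun i => ⟨(key _ _).2 ?_, fun h => (hu i).2 ?_⟩⟩
      · rw [hσ]; exact (hu i).1
      · rw [← hσ, h, sign_zero]
  rw [this]
  refine (Set.toFinite _).isClosed_biUnion fun σ _ => ?_
  simp only [ofPred_forall, ofPred_and]
  refine isClosed_iInter fun i => IsClosed.inter
    (isClosed_le continuous_const (by fun_prop)) ?_
  by_cases h : σ i = 0
  · simpa [h] using isClosed_eq (continuous_apply i) continuous_const
  · simp [h]

/-- On the sign cone, the coefficients are controlled by the linear combination they define. -/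
lemma exists_norm_le_of_mem_signCone (m : ι → E →L[ℝ] ℝ) :
    ∃ C : ℝ, ∀ u ∈ signCone m, ‖u‖ ≤ C * ‖∑ i, u i • m i‖ := by
  have hK : IsCompact (Metric.sphere (0 : ι → ℝ) 1 ∩ signCone m) :=
    (isCompact_sphere _ _).inter_right (isClosed_signCone m)
  have hcont : ContinuousOn (fun u : ι → ℝ => ‖∑ i, u i • m i‖⁻¹)
      (Metric.sphere (0 : ι → ℝ) 1 ∩ signCone m) := by
    refine ContinuousOn.inv₀ (by fun_prop) fun u hu h => ?_
    have := eq_zero_of_mem_signCone hu.2 (norm_eq_zero.1 h)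
    simp [this] at hu
  obtain ⟨C, hC⟩ := hK.exists_bound_of_continuousOn hcont
  refine ⟨C, fun u hu => ?_⟩
  rcases eq_or_ne u 0 with rfl | h0
  · simp
  have hpos : 0 < ‖u‖ := norm_pos_iff.2 h0
  have hT : 0 < ‖∑ i, u i • m i‖ :=
    norm_pos_iff.2 fun h => h0 (eq_zero_of_mem_signCone hu h)
  have := hC (‖u‖⁻¹ • u) ⟨by simp [norm_smul, hpos.ne'],
    smul_mem_signCone hu (inv_nonneg.2 hpos.le)⟩
  simp only [Pi.smul_apply, smul_assoc, ← Finset.smul_sum, norm_smul, norm_inv, norm_norm,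
    mul_inv, inv_inv] at this
  exact (div_le_iff₀ hT).1 ((le_abs_self _).trans this)

end SignCone

section Polytope

variable {n N : ℕ} {L : Fin N → (Euc n →ᵃ[ℝ] ℝ)}

/-- The open polyhedron cut out by the affine maps `L i`. -/
def openPolyhedron (L : Fin N → (Euc n →ᵃ[ℝ] ℝ)) : Set (Euc n) := {x | ∀ i, 0 < L i x}

lemma continuous_affine (f : Euc n →ᵃ[ℝ] ℝ) : Continuous f :=
  f.continuous_of_finiteDimensional

lemma isOpen_openPolyhedron : IsOpen (openPolyhedron L) := by
  simp only [openPolyhedron, ofPred_forall]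
  exact isOpen_iInter_of_finite fun i => isOpen_lt continuous_const (continuous_affine _)

lemma nonneg_of_mem_closure_openPolyhedron {x : Euc n} (hx : x ∈ closure (openPolyhedron L))
    (i : Fin N) : 0 ≤ L i x :=
  closure_minimal (fun _ hy => (hy i).le) (isClosed_le continuous_const (continuous_affine _)) hx

lemma affine_add_smul (f : Euc n →ᵃ[ℝ] ℝ) (x v : Euc n) (t : ℝ) :
    f (x + t • v) = f x + t * f.linear v := by
  have := f.map_vadd x (t • v)
  simp only [vadd_eq_add, map_smul, smul_eq_mul] at this
  rw [add_comm, this, add_comm]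

lemma affine_add_smul_sub (f : Euc n →ᵃ[ℝ] ℝ) (x y : Euc n) (t : ℝ) :
    f (x + t • (y - x)) = f x + t * (f y - f x) := by
  rw [affine_add_smul, ← vsub_eq_sub y x, f.linearMap_vsub, vsub_eq_sub]

lemma exists_linear_neg (hbdd : Bornology.IsBounded (openPolyhedron L)) {x v : Euc n}
    (hx : x ∈ openPolyhedron L) (hv : v ≠ 0) : ∃ i, (L i).linear v < 0 := by
  by_contra! h
  obtain ⟨R, hR⟩ := hbdd.exists_norm_le
  have hvpos : 0 < ‖v‖ := norm_pos_iff.2 hv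
  have hR0 : 0 ≤ R := (norm_nonneg x).trans (hR x hx)
  set t : ℝ := (R + ‖x‖ + 1) / ‖v‖ with ht
  have ht0 : 0 ≤ t := by positivity
  have hmem : x + t • v ∈ openPolyhedron L := fun i => by
    rw [affine_add_smul]
    have := mul_nonneg ht0 (h i)
    linarith [hx i]
  have h1 := hR _ hmem
  have h2 : ‖t • v‖ = R + ‖x‖ + 1 := by
    rw [norm_smul, Real.norm_of_nonneg ht0, ht, div_mul_cancel₀ _ hvpos.ne']
  have h3 := norm_sub_le (x + t • v) x
  rw [add_sub_cancel_left] at h3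
  linarith

/-- The ray from `x` through `y` leaves the polytope at a parameter `t > 1`, and the value
`log (t / (t - 1))` is the largest of the `log (L i x) - log (L i y)`. -/
lemma exists_exit_param (hbdd : Bornology.IsBounded (openPolyhedron L)) {x y : Euc n}
    (hx : x ∈ openPolyhedron L) (hy : y ∈ openPolyhedron L) (hxy : x ≠ y) :
    ∃ t : ℝ, 1 < t ∧ x + t • (y - x) ∈ frontier (openPolyhedron L) ∧
      (∃ i, Real.log (t / (t - 1)) = Real.log (L i x) - Real.log (L i y)) ∧
      ∀ i, Real.log (L i x) - Real.log (L i y) ≤ Real.log (t / (t - 1)) := by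
  have hlin (i : Fin N) : (L i).linear (y - x) = L i y - L i x := by
    rw [← vsub_eq_sub y x, (L i).linearMap_vsub, vsub_eq_sub]
  obtain ⟨k, hk⟩ := exists_linear_neg hbdd hx (sub_ne_zero.2 hxy.symm)
  obtain ⟨i, hi, hmin⟩ := (Finset.univ.filter fun i => L i y < L i x).exists_min_image
    (fun i => L i x / (L i x - L i y)) ⟨k, by
      rw [hlin] at hk
      simpa using hk⟩
  simp only [Finset.mem_filter, Finset.mem_univ, true_and] at hi hmin
  set t := L i x / (L i x - L i y) with ht
  have hd : 0 < L i x - L i y := sub_pos.2 hi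
  have ht1 : 1 < t := by
    rw [ht, one_lt_div hd]
    linarith [hy i]
  have hzero : L i x + t * (L i y - L i x) = 0 := by
    rw [ht]
    field_simp
    ring
  have hlt (j : Fin N) (s : ℝ) (hs0 : 0 ≤ s) (hs : s < t) :
      0 < L j x + s * (L j y - L j x) := by
    rcases lt_or_ge (L j y) (L j x) with h | h
    · have h1 := hs.trans_le (hmin j h)
      rw [lt_div_iff₀ (sub_pos.2 h)] at h1
      linarith
    · have := mul_nonneg hs0 (sub_nonneg.2 h)
      linarith [hx j]
  have hle (j : Fin N) : 0 ≤ L j x + t * (L j y - L j x) := by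
    rcases lt_or_ge (L j y) (L j x) with h | h
    · have h1 := hmin j h
      rw [le_div_iff₀ (sub_pos.2 h)] at h1
      linarith
    · have := mul_nonneg (zero_le_one.trans ht1.le) (sub_nonneg.2 h)
      linarith [hx j]
  refine ⟨t, ht1, ?_, ⟨i, ?_⟩, fun j => ?_⟩
  · rw [isOpen_openPolyhedron.frontier_eq]
    refine ⟨?_, fun h => ?_⟩
    · have hcl : t ∈ closure (Ico 0 t) := by
        rw [closure_Ico (by linarith)]
        exact ⟨by linarith, le_rfl⟩
      have hc : Continuous fun s : ℝ => x + s • (y - x) := by fun_prop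
      refine hc.continuousOn.image_closure.trans (closure_mono ?_) (mem_image_of_mem _ hcl)
      rintro _ ⟨s, hs, rfl⟩ j
      rw [affine_add_smul_sub]
      exact hlt j s hs.1 hs.2
    · have := h i
      rw [affine_add_smul_sub, hzero] at this
      exact lt_irrefl _ this
  · rw [← Real.log_div (hx i).ne' (hy i).ne']
    congr 1
    rw [div_eq_div_iff (by linarith) (hy i).ne']
    linarith
  · rw [← Real.log_div (hx j).ne' (hy j).ne']
    refine Real.log_le_log (div_pos (hx j) (hy j)) ?_
    rw [div_le_div_iff₀ (hy j) (by linarith)]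
    linarith [hle j]

lemma norm_ratio {x y : Euc n} (hxy : x ≠ y) {t : ℝ} (ht : 1 < t) :
    ‖x - (x + t • (y - x))‖ / ‖y - (x + t • (y - x))‖ = t / (t - 1) := by
  have h1 : x - (x + t • (y - x)) = (-t) • (y - x) := by module
  have h2 : y - (x + t • (y - x)) = (-(t - 1)) • (y - x) := by module
  have h3 : ‖y - x‖ ≠ 0 := norm_ne_zero_iff.2 (sub_ne_zero.2 hxy.symm)
  rw [h1, h2, norm_smul, norm_smul, norm_neg, norm_neg, Real.norm_of_nonneg (by linarith),
    Real.norm_of_nonneg (by linarith), mul_div_mul_right _ _ h3]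

/-- The difference of the logarithmic coordinates of `x` and `y`. -/
def logDiff (L : Fin N → (Euc n →ᵃ[ℝ] ℝ)) (x y : Euc n) : Fin N → ℝ :=
  fun i => Real.log (L i x) - Real.log (L i y)

/-- The Hilbert distance is comparable to the sup distance in logarithmic coordinates. -/
lemma IsHilbertDist.bounds_logDiff (hbdd : Bornology.IsBounded (openPolyhedron L))
    {d : Euc n → Euc n → ℝ} (hd : IsHilbertDist (openPolyhedron L) d) {x y : Euc n}
    (hx : x ∈ openPolyhedron L) (hy : y ∈ openPolyhedron L) :
    ‖logDiff L x y‖ ≤ 2 * d x y ∧ d x y ≤ ‖logDiff L x y‖ := by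
  rcases eq_or_ne x y with rfl | hxy
  · have : logDiff L x x = 0 := by
      funext i
      simp [logDiff]
    simp [hd.1 x hx, this]
  obtain ⟨t, ht, hb, ⟨i, hi⟩, hmax⟩ := exists_exit_param hbdd hx hy hxy
  obtain ⟨s, hs, ha, ⟨j, hj⟩, hmin⟩ := exists_exit_param hbdd hy hx hxy.symm
  have hdxy := hd.2 x hx y hy hxy _ _ ha hb ⟨1 - s, t, by linarith, ht, by module, rfl⟩
  have hpos {r : ℝ} (hr : 1 < r) : 1 < r / (r - 1) := by
    rw [one_lt_div (by linarith)]
    linarith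
  have ht' := hpos ht
  have hs' := hpos hs
  rw [norm_ratio hxy ht, norm_ratio hxy.symm hs, Real.log_mul (by positivity) (by positivity)]
    at hdxy
  have hlt := Real.log_pos ht'
  have hls := Real.log_pos hs'
  constructor
  · refine (pi_norm_le_iff_of_nonneg (by linarith)).2 fun k => ?_
    rw [Real.norm_eq_abs, abs_le, logDiff]
    constructor
    · linarith [hmin k]
    · linarith [hmax k]
  · have h1 := norm_le_pi_norm (logDiff L x y) i
    have h2 := norm_le_pi_norm (logDiff L x y) j
    rw [Real.norm_eq_abs, logDiff] at h1 h2
    linarith [le_abs_self (Real.log (L i x) - Real.log (L i y)),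
      neg_abs_le (Real.log (L j x) - Real.log (L j y))]

/-- The linear parts of the defining affine maps, as continuous linear forms. -/
def linearForms (L : Fin N → (Euc n →ᵃ[ℝ] ℝ)) (i : Fin N) : Euc n →L[ℝ] ℝ :=
  LinearMap.toContinuousLinearMap (L i).linear

lemma linearForms_sub (i : Fin N) (x y : Euc n) : linearForms L i (x - y) = L i x - L i y := by
  change (L i).linear (x - y) = _
  rw [← vsub_eq_sub x y, (L i).linearMap_vsub, vsub_eq_sub]

lemma logDiff_mem_signCone {x y : Euc n} (hx : x ∈ openPolyhedron L)
    (hy : y ∈ openPolyhedron L) : logDiff L x y ∈ signCone (linearForms L) := by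
  refine ⟨x - y, fun i => ?_⟩
  rw [linearForms_sub, logDiff]
  refine ⟨?_, fun h => by rw [sub_eq_zero.1 h, sub_self]⟩
  rcases le_total (L i x) (L i y) with h | h
  · exact mul_nonneg_of_nonpos_of_nonpos (by linarith)
      (by linarith [Real.log_le_log (hx i) h])
  · exact mul_nonneg (by linarith) (by linarith [Real.log_le_log (hy i) h])

lemma eq_of_logDiff_eq_zero (hbdd : Bornology.IsBounded (openPolyhedron L)) {x y : Euc n}
    (hx : x ∈ openPolyhedron L) (hy : y ∈ openPolyhedron L) (h : logDiff L x y = 0) : x = y := by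
  by_contra hxy
  obtain ⟨i, hi⟩ := exists_linear_neg hbdd hx (sub_ne_zero.2 hxy)
  have h1 := linearForms_sub (L := L) i x y
  change (L i).linear (x - y) = _ at h1
  have h2 : L i x = L i y :=
    Real.log_injOn_pos (hx i) (hy i) (sub_eq_zero.1 (congrFun h i))
  linarith

/-- A minimizer over the closed polytope of the entropy minus a linear form is interior. -/
lemma mem_openPolyhedron_of_isMinOn {p x : Euc n} (hp : p ∈ openPolyhedron L)
    {η : Euc n →L[ℝ] ℝ} (hx : x ∈ closure (openPolyhedron L))
    (hmin : IsMinOn (fun z => ∑ i, L i z * Real.log (L i z) - η z)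
      (closure (openPolyhedron L)) x) : x ∈ openPolyhedron L := by
  by_contra hxP
  have hx0 := nonneg_of_mem_closure_openPolyhedron hx
  obtain ⟨k, hk⟩ : ∃ k, L k x ≤ 0 := by simpa [openPolyhedron] using hxP
  have hk0 : L k x = 0 := le_antisymm hk (hx0 k)
  set K : ℝ := ∑ i, (L i p * Real.log (L i p) - L i x * Real.log (L i x)) - η (p - x) with hK
  have hineq (t : ℝ) (ht0 : 0 < t) (ht1 : t ≤ 1) : 0 ≤ K + L k p * Real.log t := by
    have hmem : x + t • (p - x) ∈ closure (openPolyhedron L) := by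
      refine subset_closure fun i => ?_
      rw [affine_add_smul_sub]
      nlinarith [mul_pos ht0 (hp i), mul_nonneg (sub_nonneg.2 ht1) (hx0 i)]
    have h1 := isMinOn_iff.1 hmin _ hmem
    have hterm (i : Fin N) : L i (x + t • (p - x)) * Real.log (L i (x + t • (p - x))) ≤
        L i x * Real.log (L i x) + t * (L i p * Real.log (L i p) - L i x * Real.log (L i x)) +
          if i = k then t * (L k p * Real.log t) else 0 := by
      rw [affine_add_smul_sub]
      split_ifs with hik
      · subst hik
        rw [hk0, sub_zero, zero_add, Real.log_mul ht0.ne' (hp i).ne']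
        apply le_of_eq
        ring
      · have := Real.convexOn_mul_log.2 (hx0 i) (hp i).le (sub_nonneg.2 ht1) ht0.le
          (by ring : 1 - t + t = 1)
        simp only [smul_eq_mul] at this
        have e : L i x + t * (L i p - L i x) = (1 - t) * L i x + t * L i p := by ring
        rw [e]
        linarith
    have hsum := Finset.sum_le_sum fun i (_ : i ∈ Finset.univ) => hterm i
    rw [Finset.sum_add_distrib, Finset.sum_add_distrib, ← Finset.mul_sum, Finset.sum_ite_eq'
      Finset.univ k, if_pos (Finset.mem_univ k)] at hsum
    simp only [map_add, map_smul, smul_eq_mul] at h1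
    have : 0 ≤ t * (K + L k p * Real.log t) := by
      rw [hK]
      linarith
    exact nonneg_of_mul_nonneg_right this ht0
  have hpk := hp k
  have h2 := hineq (Real.exp (-(|K| + 1) / L k p)) (Real.exp_pos _) (Real.exp_le_one_iff.2
    (div_nonpos_of_nonpos_of_nonneg (by linarith [abs_nonneg K]) hpk.le))
  rw [Real.log_exp, mul_div_cancel₀ _ hpk.ne'] at h2
  linarith [le_abs_self K]

lemma hasFDerivAt_affine (f : Euc n →ᵃ[ℝ] ℝ) (x : Euc n) :
    HasFDerivAt f (LinearMap.toContinuousLinearMap f.linear) x := by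
  have h : (f : Euc n → ℝ) = fun z => LinearMap.toContinuousLinearMap f.linear z + f 0 := by
    funext z
    have := congrFun f.decomp z
    simpa using this
  rw [h]
  exact (ContinuousLinearMap.hasFDerivAt _).add_const _

lemma exists_sum_log_smul_eq (hbdd : Bornology.IsBounded (openPolyhedron L))
    (hne : (openPolyhedron L).Nonempty) (ξ : Euc n →L[ℝ] ℝ) :
    ∃ x ∈ openPolyhedron L, ∑ i, Real.log (L i x) • linearForms L i = ξ := by
  obtain ⟨p, hp⟩ := hne
  set η : Euc n →L[ℝ] ℝ := ξ + ∑ i, linearForms L i with hη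
  have hcont : Continuous fun z => ∑ i, L i z * Real.log (L i z) - η z :=
    (continuous_finsetSum _ fun i _ =>
      Real.continuous_mul_log.comp (continuous_affine (L i))).sub η.continuous
  obtain ⟨x, hx, hmin⟩ := hbdd.isCompact_closure.exists_isMinOn ⟨p, subset_closure hp⟩
    hcont.continuousOn
  have hxP := mem_openPolyhedron_of_isMinOn hp hx hmin
  refine ⟨x, hxP, ?_⟩
  have hderiv : HasFDerivAt (fun z => ∑ i, L i z * Real.log (L i z) - η z)
      (∑ i, (Real.log (L i x) + 1) • linearForms L i - η) x :=
    (HasFDerivAt.fun_sum fun i _ => (Real.hasDerivAt_mul_log (hxP i).ne').comp_hasFDerivAt x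
      (hasFDerivAt_affine (L i) x)).sub η.hasFDerivAt
  have h0 := (hmin.isLocalMin (Filter.mem_of_superset
    (isOpen_openPolyhedron.mem_nhds hxP) subset_closure)).hasFDerivAt_eq_zero hderiv
  simp only [add_smul, one_smul, Finset.sum_add_distrib] at h0
  rw [hη, add_sub_add_right_eq_sub, sub_eq_zero] at h0
  exact h0

end Polytope

/-- **Bernig's map.**  Let `P = {x | Lᵢ(x) > 0, 1 ≤ i ≤ N}` be a bounded convex polytope with
non-empty interior defined by affine maps `L₁, …, L_N`, and let `dLᵢ` be the linear part of
`Lᵢ`.  The map `Φ_b(x) = Σᵢ log(Lᵢ(x))·dLᵢ` is a bijection from `int P` onto the dual space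
`(ℝⁿ)*` and is bi-Lipschitz from `(int P, d_P)` to `(ℝⁿ)*` with the dual Euclidean norm. -/
theorem bernig_map_biLipschitz {n N : ℕ}
    (L : Fin N → (Euc n →ᵃ[ℝ] ℝ))
    (P : Set (Euc n)) (hP : P = {x : Euc n | ∀ i, 0 < L i x})
    (hbdd : Bornology.IsBounded P) (hne : P.Nonempty)
    (d : Euc n → Euc n → ℝ) (hd : IsHilbertDist P d)
    (Φb : Euc n → (Euc n →L[ℝ] ℝ))
    (hΦb : ∀ x : Euc n, Φb x =
      ∑ i, Real.log (L i x) • (LinearMap.toContinuousLinearMap (L i).linear)) :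
    Set.BijOn Φb P Set.univ ∧
      ∃ A : ℝ, 1 ≤ A ∧ ∀ x ∈ P, ∀ y ∈ P,
        (1 / A) * ‖Φb x - Φb y‖ ≤ d x y ∧ d x y ≤ A * ‖Φb x - Φb y‖ := by
  replace hP : P = openPolyhedron L := hP
  subst hP
  have hsub (x y : Euc n) : Φb x - Φb y = ∑ i, logDiff L x y i • linearForms L i := by
    rw [hΦb, hΦb, ← Finset.sum_sub_distrib]
    exact Finset.sum_congr rfl fun i _ => (sub_smul _ _ _).symm
  obtain ⟨C, hC⟩ := exists_norm_le_of_mem_signCone (linearForms L)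
  have hlow {x y : Euc n} (hx : x ∈ openPolyhedron L) (hy : y ∈ openPolyhedron L) :
      ‖logDiff L x y‖ ≤ C * ‖Φb x - Φb y‖ := by
    rw [hsub]
    exact hC _ (logDiff_mem_signCone hx hy)
  refine ⟨⟨fun x _ => mem_univ _, fun x hx y hy h => ?_, fun ξ _ => ?_⟩, ?_⟩
  · refine eq_of_logDiff_eq_zero hbdd hx hy (norm_le_zero_iff.1 ?_)
    simpa [h] using hlow hx hy
  · obtain ⟨x, hx, h⟩ := exists_sum_log_smul_eq hbdd hne ξ
    exact ⟨x, hx, (hΦb x).trans h⟩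
  · set S := ∑ i, ‖linearForms L i‖ with hS
    have hS0 : 0 ≤ S := Finset.sum_nonneg fun i _ => norm_nonneg _
    have hA : 0 < 1 + 2 * S + |C| := by positivity
    refine ⟨1 + 2 * S + |C|, by linarith [abs_nonneg C], fun x hx y hy => ?_⟩
    obtain ⟨h1, h2⟩ := hd.bounds_logDiff hbdd hx hy
    have hd0 : 0 ≤ d x y := by linarith [norm_nonneg (logDiff L x y)]
    constructor
    · have hup : ‖Φb x - Φb y‖ ≤ S * ‖logDiff L x y‖ := by
        rw [hsub, hS, Finset.sum_mul]
        refine norm_sum_le_of_le _ fun i _ => ?_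
        rw [norm_smul, mul_comm]
        exact mul_le_mul_of_nonneg_left (norm_le_pi_norm _ i) (norm_nonneg _)
      rw [one_div, inv_mul_le_iff₀ hA]
      nlinarith [mul_le_mul_of_nonneg_left h1 hS0, mul_nonneg (abs_nonneg C) hd0]
    · refine (h2.trans (hlow hx hy)).trans (mul_le_mul_of_nonneg_right ?_ (norm_nonneg _))
      linarith [le_abs_self C]
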